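/- A SAND attack tree is a normal form of the term rewriting system ⇒ (i.e., no rewrite rule is applicable to it, modulo commutativity of OR and AND) if and only if it is generated by the non-terminal N of the normal-form grammar. -/

import Mathlib

/-!
Formalization of "Attack Trees with Sequential Conjunction".

Source-sink graphs over a set `B` of basic actions: a vertex type `V`,
a multiset of labeled edges, a source `s` and a sink `z` with `s ≠ z`.
-/

structure SSG (B : Type) : Type 1 where
  V : Type
  deq : DecidableEq V
  E : Multiset (V × B × V)
  s : V
  z : V
  ne : s ≠ z

namespace SSG

variable {B : Type}

/-- The graph with a single edge labeled `b`. -/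
def single (b : B) : SSG B where
  V := Bool
  deq := inferInstance
  E := {(false, b, true)}
  s := false
  z := true
  ne := Bool.false_ne_true

/-- In the sequential composition, the sink of the first graph is identified with
the source of the second graph. -/
def seqEmbed (G G' : SSG B) (v : G.V) : ({u : G.V // u ≠ G.z} ⊕ G'.V) :=
  haveI := G.deq
  if h : v = G.z then Sum.inr G'.s else Sum.inl ⟨v, h⟩

/-- Sequential composition `G ⋅ G'` of source-sink graphs: the disjoint union in which
the sink of `G` is identified with the source of `G'`. -/
def seq (G G' : SSG B) : SSG B where
  V := {u : G.V // u ≠ G.z} ⊕ G'.V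
  deq := by haveI := G.deq; haveI := G'.deq; infer_instance
  E := G.E.map (fun e => (G.seqEmbed G' e.1, e.2.1, G.seqEmbed G' e.2.2)) +
       G'.E.map (fun e => (Sum.inr e.1, e.2.1, Sum.inr e.2.2))
  s := Sum.inl ⟨G.s, G.ne⟩
  z := Sum.inr G'.z
  ne := by simp

/-- In the parallel composition, the two sources are identified and the two sinks
are identified. -/
def parEmbed (G G' : SSG B) (v : G.V) : ({u : G.V // u ≠ G.s ∧ u ≠ G.z} ⊕ G'.V) :=
  haveI := G.deq
  if hs : v = G.s then Sum.inr G'.s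
  else if hz : v = G.z then Sum.inr G'.z
  else Sum.inl ⟨v, hs, hz⟩

/-- Parallel composition `G ∥ G'` of source-sink graphs: the disjoint union in which
the two sources are identified and the two sinks are identified. -/
def par (G G' : SSG B) : SSG B where
  V := {u : G.V // u ≠ G.s ∧ u ≠ G.z} ⊕ G'.V
  deq := by haveI := G.deq; haveI := G'.deq; infer_instance
  E := G.E.map (fun e => (G.parEmbed G' e.1, e.2.1, G.parEmbed G' e.2.2)) +
       G'.E.map (fun e => (Sum.inr e.1, e.2.1, Sum.inr e.2.2))
  s := Sum.inr G'.s
  z := Sum.inr G'.z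
  ne := fun h => G'.ne (Sum.inr_injective h)

/-- Two source-sink graphs are equal (isomorphic) if there is a bijection between their
vertex sets that preserves the labeled edges (and hence source and sink). -/
def Iso (G G' : SSG B) : Prop :=
  ∃ f : G.V ≃ G'.V,
    G.E.map (fun e => (f e.1, e.2.1, f e.2.2)) = G'.E ∧ f G.s = G'.s ∧ f G.z = G'.z

/-- Directed adjacency: there is an edge from `u` to `v`. -/
def Adj (G : SSG B) (u v : G.V) : Prop := ∃ b, (u, b, v) ∈ G.E

/-- Series-parallel graphs (SP graphs): built from single edges by sequential and
parallel composition; as SP graphs are considered up to isomorphism, the collection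
is closed under isomorphism. -/
inductive IsSP : SSG B → Prop
  | single (b : B) : IsSP (single b)
  | seq {G G' : SSG B} : IsSP G → IsSP G' → IsSP (G.seq G')
  | par {G G' : SSG B} : IsSP G → IsSP G' → IsSP (G.par G')
  | iso {G G' : SSG B} : IsSP G → G.Iso G' → IsSP G'

/-- A graph is connected if any two vertices are joined by a path in the
underlying undirected graph. -/
def Connected (G : SSG B) : Prop :=
  ∀ u v : G.V, Relation.ReflTransGen (fun a b => G.Adj a b ∨ G.Adj b a) u v

/-- A directed graph is acyclic if it has no (nonempty) directed cycle. -/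
def Acyclic (G : SSG B) : Prop := ∀ v : G.V, ¬ Relation.TransGen G.Adj v v

end SSG
/-!
SAND attack trees: closed terms over `B ∪ {OR, AND, SAND}`, where the unranked
operators take `k ≥ 1` arguments (represented by nonempty lists `SandTreeList`).
-/

mutual
inductive SandTree (B : Type) : Type
  | atom : B → SandTree B
  | or : SandTreeList B → SandTree B
  | and : SandTreeList B → SandTree B
  | sand : SandTreeList B → SandTree B
inductive SandTreeList (B : Type) : Type
  | single : SandTree B → SandTreeList B
  | cons : SandTree B → SandTreeList B → SandTreeList B
end

namespace SandTreeList

variable {B : Type}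

def toList : SandTreeList B → List (SandTree B)
  | .single t => [t]
  | .cons t ts => t :: ts.toList

/-- Prepend a (possibly empty) list of trees to a nonempty argument list. -/
def glue : List (SandTree B) → SandTreeList B → SandTreeList B
  | [], ys => ys
  | x :: xs, ys => .cons x (glue xs ys)

/-- The nonempty argument list `t :: l`. -/
def ofList : SandTree B → List (SandTree B) → SandTreeList B
  | t, [] => .single t
  | t, u :: us => .cons t (ofList u us)

/-- Append a (possibly empty) list of trees to a nonempty argument list. -/
def snoc : SandTreeList B → List (SandTree B) → SandTreeList B
  | .single t, zs => ofList t zs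
  | .cons t ts, zs => .cons t (snoc ts zs)

def map (f : SandTree B → SandTree B) : SandTreeList B → SandTreeList B
  | .single t => .single (f t)
  | .cons t ts => .cons (f t) (map f ts)

end SandTreeList

/-!
The SP semantics `sem` interprets a SAND attack tree as a set of SP graphs
(sets of source-sink graphs closed under isomorphism, since SP graphs are
considered up to isomorphism):
`⟦b⟧ = {→b}`, `⟦OR(t₁,…,t_k)⟧ = ⋃ᵢ ⟦tᵢ⟧`,
`⟦AND(t₁,…,t_k)⟧ = {G₁ ∥ … ∥ G_k | Gᵢ ∈ ⟦tᵢ⟧}`,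
`⟦SAND(t₁,…,t_k)⟧ = {G₁ ⋅ … ⋅ G_k | Gᵢ ∈ ⟦tᵢ⟧}`.
-/

mutual
def sem {B : Type} : SandTree B → Set (SSG B)
  | .atom b => {G | (SSG.single b).Iso G}
  | .or ts => semOr ts
  | .and ts => semAnd ts
  | .sand ts => semSand ts
def semOr {B : Type} : SandTreeList B → Set (SSG B)
  | .single t => sem t
  | .cons t ts => sem t ∪ semOr ts
def semAnd {B : Type} : SandTreeList B → Set (SSG B)
  | .single t => sem t
  | .cons t ts => {G | ∃ G1 ∈ sem t, ∃ G2 ∈ semAnd ts, (G1.par G2).Iso G}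
def semSand {B : Type} : SandTreeList B → Set (SSG B)
  | .single t => sem t
  | .cons t ts => {G | ∃ G1 ∈ sem t, ∃ G2 ∈ semSand ts, (G1.seq G2).Iso G}
end
/-!
Equality of terms modulo commutativity of the unranked operators `OR` and `AND`
(the congruence generated by permuting the arguments of `OR` and `AND` nodes).
-/

mutual
inductive PEq {B : Type} : SandTree B → SandTree B → Prop
  | refl (t : SandTree B) : PEq t t
  | symm {t u : SandTree B} : PEq t u → PEq u t
  | trans {t u v : SandTree B} : PEq t u → PEq u v → PEq t v
  | orPerm {ts ts' : SandTreeList B} : ts.toList.Perm ts'.toList → PEq (.or ts) (.or ts')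
  | andPerm {ts ts' : SandTreeList B} : ts.toList.Perm ts'.toList → PEq (.and ts) (.and ts')
  | orCongr {ts ts' : SandTreeList B} : PEqL ts ts' → PEq (.or ts) (.or ts')
  | andCongr {ts ts' : SandTreeList B} : PEqL ts ts' → PEq (.and ts) (.and ts')
  | sandCongr {ts ts' : SandTreeList B} : PEqL ts ts' → PEq (.sand ts) (.sand ts')
inductive PEqL {B : Type} : SandTreeList B → SandTreeList B → Prop
  | single {t t' : SandTree B} : PEq t t' → PEqL (.single t) (.single t')
  | cons {t t' : SandTree B} {ts ts' : SandTreeList B} :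
      PEq t t' → PEqL ts ts' → PEqL (.cons t ts) (.cons t' ts')
end
/-!
Syntactic consequence from the axiom system `E_SP`.

The axiom schemes are represented by all of their instances (arbitrary argument
terms in place of the variable vectors `X⃗`, `Y⃗`, `Z⃗`); on closed terms this
generates exactly the same derivability relation as variables plus the
substitution rule.  Closure under "replacement in contexts" is represented by
the congruence rules for the three operators.
-/

section
open SandTreeList
mutual
inductive DerivSP {B : Type} : SandTree B → SandTree B → Prop
  /- closure rules -/
  | refl (t : SandTree B) : DerivSP t t
  | symm {t u : SandTree B} : DerivSP t u → DerivSP u t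
  | trans {t u v : SandTree B} : DerivSP t u → DerivSP u v → DerivSP t v
  | congrOr {ts ts' : SandTreeList B} : DerivSPL ts ts' → DerivSP (.or ts) (.or ts')
  | congrAnd {ts ts' : SandTreeList B} : DerivSPL ts ts' → DerivSP (.and ts) (.and ts')
  | congrSand {ts ts' : SandTreeList B} : DerivSPL ts ts' → DerivSP (.sand ts) (.sand ts')
  /- (E1) commutativity of OR -/
  | ax1 {ts ts' : SandTreeList B} : ts.toList.Perm ts'.toList → DerivSP (.or ts) (.or ts')
  /- (E2) commutativity of AND -/
  | ax2 {ts ts' : SandTreeList B} : ts.toList.Perm ts'.toList → DerivSP (.and ts) (.and ts')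
  /- (E3) OR(X⃗, OR(Y⃗)) = OR(X⃗, Y⃗) -/
  | ax3 (xs : List (SandTree B)) (ys : SandTreeList B) :
      DerivSP (.or (glue xs (.single (.or ys)))) (.or (glue xs ys))
  /- (E4) AND(X⃗, AND(Y⃗)) = AND(X⃗, Y⃗) -/
  | ax4 (xs : List (SandTree B)) (ys : SandTreeList B) :
      DerivSP (.and (glue xs (.single (.and ys)))) (.and (glue xs ys))
  /- (E4') SAND(X⃗, SAND(Y⃗), Z⃗) = SAND(X⃗, Y⃗, Z⃗) -/
  | ax4' (xs : List (SandTree B)) (ys : SandTreeList B) (zs : List (SandTree B)) :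
      DerivSP (.sand (glue xs (snoc (.single (.sand ys)) zs))) (.sand (glue xs (snoc ys zs)))
  /- (E5) OR(A) = A -/
  | ax5 (t : SandTree B) : DerivSP (.or (.single t)) t
  /- (E6) AND(A) = A -/
  | ax6 (t : SandTree B) : DerivSP (.and (.single t)) t
  /- (E6') SAND(A) = A -/
  | ax6' (t : SandTree B) : DerivSP (.sand (.single t)) t
  /- (E10) AND(X⃗, OR(Y⃗)) = OR(AND(X⃗,Y₁),…,AND(X⃗,Yₗ)) -/
  | ax10 (xs : List (SandTree B)) (ys : SandTreeList B) :
      DerivSP (.and (glue xs (.single (.or ys))))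
        (.or (SandTreeList.map (fun y => .and (glue xs (.single y))) ys))
  /- (E10') SAND(X⃗, OR(Y⃗), Z⃗) = OR(SAND(X⃗,Y₁,Z⃗),…,SAND(X⃗,Yₗ,Z⃗)) -/
  | ax10' (xs : List (SandTree B)) (ys : SandTreeList B) (zs : List (SandTree B)) :
      DerivSP (.sand (glue xs (snoc (.single (.or ys)) zs)))
        (.or (SandTreeList.map (fun y => .sand (glue xs (snoc (.single y) zs))) ys))
  /- (E11) OR(A, A, X⃗) = OR(A, X⃗) -/
  | ax11 (a : SandTree B) (xs : List (SandTree B)) :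
      DerivSP (.or (.cons a (ofList a xs))) (.or (ofList a xs))
inductive DerivSPL {B : Type} : SandTreeList B → SandTreeList B → Prop
  | single {t t' : SandTree B} : DerivSP t t' → DerivSPL (.single t) (.single t')
  | cons {t t' : SandTree B} {ts ts' : SandTreeList B} :
      DerivSP t t' → DerivSPL ts ts' → DerivSPL (.cons t ts) (.cons t' ts')
end
end

/-! Syntactic consequence from the SAND-free fragment
`E_SM = {E1, E2, E3, E4, E5, E6, E10, E11}` of `E_SP` (formulated over the full
signature of SAND attack trees). -/
section
open SandTreeList
mutual
inductive DerivSM {B : Type} : SandTree B → SandTree B → Prop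
  | refl (t : SandTree B) : DerivSM t t
  | symm {t u : SandTree B} : DerivSM t u → DerivSM u t
  | trans {t u v : SandTree B} : DerivSM t u → DerivSM u v → DerivSM t v
  | congrOr {ts ts' : SandTreeList B} : DerivSML ts ts' → DerivSM (.or ts) (.or ts')
  | congrAnd {ts ts' : SandTreeList B} : DerivSML ts ts' → DerivSM (.and ts) (.and ts')
  | congrSand {ts ts' : SandTreeList B} : DerivSML ts ts' → DerivSM (.sand ts) (.sand ts')
  | ax1 {ts ts' : SandTreeList B} : ts.toList.Perm ts'.toList → DerivSM (.or ts) (.or ts')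
  | ax2 {ts ts' : SandTreeList B} : ts.toList.Perm ts'.toList → DerivSM (.and ts) (.and ts')
  | ax3 (xs : List (SandTree B)) (ys : SandTreeList B) :
      DerivSM (.or (glue xs (.single (.or ys)))) (.or (glue xs ys))
  | ax4 (xs : List (SandTree B)) (ys : SandTreeList B) :
      DerivSM (.and (glue xs (.single (.and ys)))) (.and (glue xs ys))
  | ax5 (t : SandTree B) : DerivSM (.or (.single t)) t
  | ax6 (t : SandTree B) : DerivSM (.and (.single t)) t
  | ax10 (xs : List (SandTree B)) (ys : SandTreeList B) :
      DerivSM (.and (glue xs (.single (.or ys))))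
        (.or (SandTreeList.map (fun y => .and (glue xs (.single y))) ys))
  | ax11 (a : SandTree B) (xs : List (SandTree B)) :
      DerivSM (.or (.cons a (ofList a xs))) (.or (ofList a xs))
inductive DerivSML {B : Type} : SandTreeList B → SandTreeList B → Prop
  | single {t t' : SandTree B} : DerivSM t t' → DerivSML (.single t) (.single t')
  | cons {t t' : SandTree B} {ts ts' : SandTreeList B} :
      DerivSM t t' → DerivSML ts ts' → DerivSML (.cons t ts) (.cons t' ts')
end
end
/-!
The normal-form grammar (for `k ≥ 2`, `b ∈ B`):
`N ::= A | OR(A₁,…,A_k)` (with pairwise distinct `Aᵢ`),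
`A ::= C | S`, `C ::= b | AND(S₁,…,S_k)`, `S ::= b | SAND(C₁,…,C_k)`.
-/

mutual
inductive IsC {B : Type} : SandTree B → Prop
  | atom (b : B) : IsC (.atom b)
  | and {ts : SandTreeList B} : 2 ≤ ts.toList.length → IsSL ts → IsC (.and ts)
inductive IsS {B : Type} : SandTree B → Prop
  | atom (b : B) : IsS (.atom b)
  | sand {ts : SandTreeList B} : 2 ≤ ts.toList.length → IsCL ts → IsS (.sand ts)
inductive IsSL {B : Type} : SandTreeList B → Prop
  | single {t : SandTree B} : IsS t → IsSL (.single t)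
  | cons {t : SandTree B} {ts : SandTreeList B} : IsS t → IsSL ts → IsSL (.cons t ts)
inductive IsCL {B : Type} : SandTreeList B → Prop
  | single {t : SandTree B} : IsC t → IsCL (.single t)
  | cons {t : SandTree B} {ts : SandTreeList B} : IsC t → IsCL ts → IsCL (.cons t ts)
end

/-- Terms generated by the non-terminal `A` of the normal-form grammar. -/
def IsA {B : Type} (t : SandTree B) : Prop := IsC t ∨ IsS t

/-- Terms generated by the non-terminal `N` of the normal-form grammar; as terms
are considered modulo commutativity of `OR` and `AND`, the arguments of the `OR`
are required to be pairwise distinct modulo commutativity. -/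
def IsN {B : Type} (t : SandTree B) : Prop :=
  IsA t ∨ ∃ ts : SandTreeList B, t = .or ts ∧ 2 ≤ ts.toList.length ∧
    (∀ u ∈ ts.toList, IsA u) ∧ ts.toList.Pairwise (fun a b => ¬ PEq a b)

/-!
The term rewriting system obtained by orienting the axioms
(E3), (E4), (E4'), (E5), (E6), (E6'), (E10), (E10'), (E11) from left to right,
applied in any context, modulo commutativity of `OR` and `AND`.
-/

section
open SandTreeList

/-- Rule application at the root. -/
inductive RStep {B : Type} : SandTree B → SandTree B → Prop
  | r3 (xs : List (SandTree B)) (ys : SandTreeList B) :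
      RStep (.or (glue xs (.single (.or ys)))) (.or (glue xs ys))
  | r4 (xs : List (SandTree B)) (ys : SandTreeList B) :
      RStep (.and (glue xs (.single (.and ys)))) (.and (glue xs ys))
  | r4' (xs : List (SandTree B)) (ys : SandTreeList B) (zs : List (SandTree B)) :
      RStep (.sand (glue xs (snoc (.single (.sand ys)) zs))) (.sand (glue xs (snoc ys zs)))
  | r5 (t : SandTree B) : RStep (.or (.single t)) t
  | r6 (t : SandTree B) : RStep (.and (.single t)) t
  | r6' (t : SandTree B) : RStep (.sand (.single t)) t
  | r10 (xs : List (SandTree B)) (ys : SandTreeList B) :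
      RStep (.and (glue xs (.single (.or ys))))
        (.or (SandTreeList.map (fun y => .and (glue xs (.single y))) ys))
  | r10' (xs : List (SandTree B)) (ys : SandTreeList B) (zs : List (SandTree B)) :
      RStep (.sand (glue xs (snoc (.single (.or ys)) zs)))
        (.or (SandTreeList.map (fun y => .sand (glue xs (snoc (.single y) zs))) ys))
  | r11 (a : SandTree B) (xs : List (SandTree B)) :
      RStep (.or (.cons a (ofList a xs))) (.or (ofList a xs))

end

/-! Rule application in an arbitrary context. -/
mutual
inductive Rw {B : Type} : SandTree B → SandTree B → Prop
  | root {t t' : SandTree B} : RStep t t' → Rw t t'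
  | or {ts ts' : SandTreeList B} : RwL ts ts' → Rw (.or ts) (.or ts')
  | and {ts ts' : SandTreeList B} : RwL ts ts' → Rw (.and ts) (.and ts')
  | sand {ts ts' : SandTreeList B} : RwL ts ts' → Rw (.sand ts) (.sand ts')
inductive RwL {B : Type} : SandTreeList B → SandTreeList B → Prop
  | single {t t' : SandTree B} : Rw t t' → RwL (.single t) (.single t')
  | head {t t' : SandTree B} {ts : SandTreeList B} : Rw t t' → RwL (.cons t ts) (.cons t' ts)
  | tail {t : SandTree B} {ts ts' : SandTreeList B} : RwL ts ts' → RwL (.cons t ts) (.cons t ts')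
end

/-- One rewrite step of the TRS `⇒`, working modulo commutativity of `OR` and `AND`. -/
def RwMod {B : Type} (t t' : SandTree B) : Prop :=
  ∃ u u' : SandTree B, PEq t u ∧ Rw u u' ∧ PEq u' t'

/-- Zero or more rewrite steps (modulo commutativity of `OR` and `AND`). -/
def RwStar {B : Type} : SandTree B → SandTree B → Prop :=
  Relation.ReflTransGen (fun a b => PEq a b ∨ Rw a b)

/-- A normal form: no rewrite rule is applicable, modulo commutativity of `OR` and `AND`. -/
def NormalForm {B : Type} (t : SandTree B) : Prop :=
  ∀ u t' : SandTree B, PEq t u → ¬ Rw u t'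

/-! The norm `‖·‖`: `‖b‖ = 1`, `‖OR(t₁,…,t_k)‖ = ‖t₁‖+…+‖t_k‖+2`,
`‖AND(t₁,…,t_k)‖ = ‖SAND(t₁,…,t_k)‖ = 2·‖t₁‖·…·‖t_k‖`. -/
mutual
def weight {B : Type} : SandTree B → ℕ
  | .atom _ => 1
  | .or ts => weightSum ts + 2
  | .and ts => 2 * weightProd ts
  | .sand ts => 2 * weightProd ts
def weightSum {B : Type} : SandTreeList B → ℕ
  | .single t => weight t
  | .cons t ts => weight t + weightSum ts
def weightProd {B : Type} : SandTreeList B → ℕ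
  | .single t => weight t
  | .cons t ts => weight t * weightProd ts
end
/-!
Standard attack trees are SAND attack trees containing no `SAND` operator.
The multiset semantics maps a standard attack tree to a set of finite multisets
over `B`: `⟦b⟧_M = {⟨b⟩}`, `⟦OR⟧_M = ⋃ᵢ ⟦tᵢ⟧_M`,
`⟦AND⟧_M = {M₁ ⊎ … ⊎ M_k | Mᵢ ∈ ⟦tᵢ⟧_M}`.
(Its value on trees containing `SAND` is irrelevant and set to `∅`.)
-/

mutual
inductive NoSand {B : Type} : SandTree B → Prop
  | atom (b : B) : NoSand (.atom b)
  | or {ts : SandTreeList B} : NoSandL ts → NoSand (.or ts)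
  | and {ts : SandTreeList B} : NoSandL ts → NoSand (.and ts)
inductive NoSandL {B : Type} : SandTreeList B → Prop
  | single {t : SandTree B} : NoSand t → NoSandL (.single t)
  | cons {t : SandTree B} {ts : SandTreeList B} : NoSand t → NoSandL ts → NoSandL (.cons t ts)
end

mutual
def msem {B : Type} : SandTree B → Set (Multiset B)
  | .atom b => {({b} : Multiset B)}
  | .or ts => msemOr ts
  | .and ts => msemAnd ts
  | .sand _ => ∅
def msemOr {B : Type} : SandTreeList B → Set (Multiset B)
  | .single t => msem t
  | .cons t ts => msem t ∪ msemOr ts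
def msemAnd {B : Type} : SandTreeList B → Set (Multiset B)
  | .single t => msem t
  | .cons t ts => {M | ∃ M1 ∈ msem t, ∃ M2 ∈ msemAnd ts, M = M1 + M2}
end

/-- Parallel composition of a nonempty list of graphs `G ∥ H₁ ∥ … ∥ H_k`. -/
def parAll {B : Type} : SSG B → List (SSG B) → SSG B
  | G, [] => G
  | G, H :: Hs => parAll (G.par H) Hs

/-- SAND attack trees modulo equivalence with respect to the SP semantics
(`t ~ t'` iff `⟦t⟧ = ⟦t'⟧`). -/
def semSetoid (B : Type) : Setoid (SandTree B) :=
  ⟨fun t t' => sem t = sem t', fun _ => rfl, Eq.symm, Eq.trans⟩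

/-- The map induced by the SP semantics on equivalence classes of SAND attack trees. -/
def semClass {B : Type} : Quotient (semSetoid B) → Set (SSG B) :=
  Quotient.lift sem (fun _ _ h => h)

/-!
Bottom-up evaluation of the minimal attack time attribute on SAND attack trees:
`α(b) = β(b)`, `α(OR) = min`, `α(AND) = max`, `α(SAND) = Σ`.
-/

mutual
def attr {B : Type} (β : B → NNReal) : SandTree B → NNReal
  | .atom b => β b
  | .or ts => attrOr β ts
  | .and ts => attrAnd β ts
  | .sand ts => attrSand β ts
def attrOr {B : Type} (β : B → NNReal) : SandTreeList B → NNReal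
  | .single t => attr β t
  | .cons t ts => min (attr β t) (attrOr β ts)
def attrAnd {B : Type} (β : B → NNReal) : SandTreeList B → NNReal
  | .single t => attr β t
  | .cons t ts => max (attr β t) (attrAnd β ts)
def attrSand {B : Type} (β : B → NNReal) : SandTreeList B → NNReal
  | .single t => attr β t
  | .cons t ts => attr β t + attrSand β ts
end
/-!
Standard attack trees as a standalone signature (`B ∪ {OR, AND}`, unranked
operators with `k ≥ 1` arguments), their multiset semantics, and syntactic
consequence from the axiom system `E_SM`.
-/

mutual
inductive ATree (B : Type) : Type
  | atom : B → ATree B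
  | or : ATreeList B → ATree B
  | and : ATreeList B → ATree B
inductive ATreeList (B : Type) : Type
  | single : ATree B → ATreeList B
  | cons : ATree B → ATreeList B → ATreeList B
end

namespace ATreeList

variable {B : Type}

def toList : ATreeList B → List (ATree B)
  | .single t => [t]
  | .cons t ts => t :: ts.toList

def glue : List (ATree B) → ATreeList B → ATreeList B
  | [], ys => ys
  | x :: xs, ys => .cons x (glue xs ys)

def ofList : ATree B → List (ATree B) → ATreeList B
  | t, [] => .single t
  | t, u :: us => .cons t (ofList u us)

def map (f : ATree B → ATree B) : ATreeList B → ATreeList B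
  | .single t => .single (f t)
  | .cons t ts => .cons (f t) (map f ts)

end ATreeList

/-! The multiset semantics of standard attack trees. -/

mutual
def amsem {B : Type} : ATree B → Set (Multiset B)
  | .atom b => {({b} : Multiset B)}
  | .or ts => amsemOr ts
  | .and ts => amsemAnd ts
def amsemOr {B : Type} : ATreeList B → Set (Multiset B)
  | .single t => amsem t
  | .cons t ts => amsem t ∪ amsemOr ts
def amsemAnd {B : Type} : ATreeList B → Set (Multiset B)
  | .single t => amsem t
  | .cons t ts => {M | ∃ M1 ∈ amsem t, ∃ M2 ∈ amsemAnd ts, M = M1 + M2}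
end

/-!
Syntactic consequence from `E_SM = {E1, E2, E3, E4, E5, E6, E10, E11}`.
Axiom schemes are represented by all of their instances (closure under
substitution is then automatic), and closure under replacement in contexts is
represented by the congruence rules.
-/

section
open ATreeList
mutual
inductive DerivASM {B : Type} : ATree B → ATree B → Prop
  | refl (t : ATree B) : DerivASM t t
  | symm {t u : ATree B} : DerivASM t u → DerivASM u t
  | trans {t u v : ATree B} : DerivASM t u → DerivASM u v → DerivASM t v
  | congrOr {ts ts' : ATreeList B} : DerivASML ts ts' → DerivASM (.or ts) (.or ts')
  | congrAnd {ts ts' : ATreeList B} : DerivASML ts ts' → DerivASM (.and ts) (.and ts')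
  /- (E1) -/
  | ax1 {ts ts' : ATreeList B} : ts.toList.Perm ts'.toList → DerivASM (.or ts) (.or ts')
  /- (E2) -/
  | ax2 {ts ts' : ATreeList B} : ts.toList.Perm ts'.toList → DerivASM (.and ts) (.and ts')
  /- (E3) -/
  | ax3 (xs : List (ATree B)) (ys : ATreeList B) :
      DerivASM (.or (glue xs (.single (.or ys)))) (.or (glue xs ys))
  /- (E4) -/
  | ax4 (xs : List (ATree B)) (ys : ATreeList B) :
      DerivASM (.and (glue xs (.single (.and ys)))) (.and (glue xs ys))
  /- (E5) -/
  | ax5 (t : ATree B) : DerivASM (.or (.single t)) t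
  /- (E6) -/
  | ax6 (t : ATree B) : DerivASM (.and (.single t)) t
  /- (E10) -/
  | ax10 (xs : List (ATree B)) (ys : ATreeList B) :
      DerivASM (.and (glue xs (.single (.or ys))))
        (.or (ATreeList.map (fun y => .and (glue xs (.single y))) ys))
  /- (E11) -/
  | ax11 (a : ATree B) (xs : List (ATree B)) :
      DerivASM (.or (.cons a (ofList a xs))) (.or (ofList a xs))
inductive DerivASML {B : Type} : ATreeList B → ATreeList B → Prop
  | single {t t' : ATree B} : DerivASM t t' → DerivASML (.single t) (.single t')
  | cons {t t' : ATree B} {ts ts' : ATreeList B} :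
      DerivASM t t' → DerivASML ts ts' → DerivASML (.cons t ts) (.cons t' ts')
end
end

namespace SandTreeList

variable {B : Type}

@[simp]
theorem toList_single (t : SandTree B) : (single t).toList = [t] := by
  rw [toList]

@[simp]
theorem toList_cons (t : SandTree B) (ts : SandTreeList B) :
    (cons t ts).toList = t :: ts.toList := by
  rw [toList]

@[simp]
theorem toList_glue (xs : List (SandTree B)) (ts : SandTreeList B) :
    (glue xs ts).toList = xs ++ ts.toList := by
  induction xs with
  | nil => simp [glue]
  | cons x xs ih => simp [glue, ih]

@[simp]
theorem toList_ofList (t : SandTree B) (l : List (SandTree B)) :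
    (ofList t l).toList = t :: l := by
  induction l generalizing t with
  | nil => simp [ofList]
  | cons u us ih => simp [ofList, ih]

/-- Structural induction on argument lists, without a motive for trees. -/
theorem list_induction {motive : SandTreeList B → Prop} (single : ∀ t, motive (.single t))
    (cons : ∀ t ts, motive ts → motive (.cons t ts)) : ∀ ts, motive ts
  | .single t => single t
  | .cons t ts => cons t ts (list_induction single cons ts)

theorem exists_eq_ofList (ts : SandTreeList B) : ∃ t l, ts = ofList t l := by
  induction ts using list_induction with
  | single t => exact ⟨t, [], by simp [ofList]⟩
  | cons t ts ih =>
    obtain ⟨u, l, rfl⟩ := ih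
    exact ⟨t, u :: l, by simp [ofList]⟩

theorem exists_eq_glue_snoc_of_mem {u : SandTree B} {ts : SandTreeList B}
    (h : u ∈ ts.toList) : ∃ xs zs, ts = glue xs (snoc (.single u) zs) := by
  induction ts using list_induction with
  | single t =>
    obtain rfl : u = t := by simpa using h
    exact ⟨[], [], by simp [glue, snoc, ofList]⟩
  | cons t ts ih =>
    rw [toList_cons, List.mem_cons] at h
    rcases h with rfl | h
    · obtain ⟨v, l, rfl⟩ := ts.exists_eq_ofList
      exact ⟨[], v :: l, by simp [glue, snoc, ofList]⟩
    · obtain ⟨xs, zs, rfl⟩ := ih h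
      exact ⟨t :: xs, zs, by simp [glue]⟩

theorem exists_perm_glue_of_mem {u : SandTree B} {ts : SandTreeList B}
    (h : u ∈ ts.toList) : ∃ xs, ts.toList.Perm (glue xs (.single u)).toList := by
  obtain ⟨l₁, l₂, h⟩ := List.append_of_mem h
  refine ⟨l₁ ++ l₂, ?_⟩
  rw [h, toList_glue, toList_single]
  exact List.perm_middle.trans (List.perm_append_singleton u (l₁ ++ l₂)).symm

theorem two_le_length_toList {ts : SandTreeList B} (h : ∀ t, ts ≠ .single t) :
    2 ≤ ts.toList.length := by
  cases ts with
  | single t => exact absurd rfl (h t)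
  | cons t ts => cases ts <;> simp

end SandTreeList

open SandTreeList

theorem List.exists_perm_of_not_pairwise {α : Type*} {r : α → α → Prop} {l : List α}
    (h : ¬ l.Pairwise fun a b => ¬ r a b) : ∃ a b xs, r a b ∧ l.Perm (a :: b :: xs) := by
  induction l with
  | nil => simp at h
  | cons c l ih =>
    rw [List.pairwise_cons, not_and_or] at h
    rcases h with h | h
    · push Not at h
      obtain ⟨b, hb, hr⟩ := h
      obtain ⟨l₁, l₂, rfl⟩ := List.append_of_mem hb
      exact ⟨c, b, l₁ ++ l₂, hr, List.perm_middle.cons c⟩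
    · obtain ⟨a, b, xs, hr, hp⟩ := ih h
      exact ⟨a, b, c :: xs, hr, (hp.cons c).trans
        ((List.Perm.swap a c _).trans ((List.Perm.swap b c xs).cons a))⟩

variable {B : Type}

theorem isSL_iff {ts : SandTreeList B} : IsSL ts ↔ ∀ u ∈ ts.toList, IsS u := by
  induction ts using list_induction with
  | single t => simpa using ⟨fun h => by cases h; assumption, IsSL.single⟩
  | cons t ts ih =>
    simp only [toList_cons, List.forall_mem_cons, ← ih]
    exact ⟨fun h => by cases h; constructor <;> assumption, fun h => .cons h.1 h.2⟩

theorem isCL_iff {ts : SandTreeList B} : IsCL ts ↔ ∀ u ∈ ts.toList, IsC u := by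
  induction ts using list_induction with
  | single t => simpa using ⟨fun h => by cases h; assumption, IsCL.single⟩
  | cons t ts ih =>
    simp only [toList_cons, List.forall_mem_cons, ← ih]
    exact ⟨fun h => by cases h; constructor <;> assumption, fun h => .cons h.1 h.2⟩

theorem isC_and_iff {ts : SandTreeList B} :
    IsC (.and ts) ↔ 2 ≤ ts.toList.length ∧ ∀ u ∈ ts.toList, IsS u := by
  rw [← isSL_iff]
  exact ⟨fun h => by cases h; constructor <;> assumption, fun h => .and h.1 h.2⟩

theorem isS_sand_iff {ts : SandTreeList B} :
    IsS (.sand ts) ↔ 2 ≤ ts.toList.length ∧ ∀ u ∈ ts.toList, IsC u := by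
  rw [← isCL_iff]
  exact ⟨fun h => by cases h; constructor <;> assumption, fun h => .sand h.1 h.2⟩

theorem not_isC_or (ts : SandTreeList B) : ¬ IsC (.or ts) := nofun
theorem not_isC_sand (ts : SandTreeList B) : ¬ IsC (.sand ts) := nofun
theorem not_isS_or (ts : SandTreeList B) : ¬ IsS (.or ts) := nofun
theorem not_isS_and (ts : SandTreeList B) : ¬ IsS (.and ts) := nofun

theorem not_isA_or (ts : SandTreeList B) : ¬ IsA (.or ts) := by
  simp [IsA, not_isC_or, not_isS_or]

theorem isN_or_iff {ts : SandTreeList B} :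
    IsN (.or ts) ↔ 2 ≤ ts.toList.length ∧ (∀ u ∈ ts.toList, IsA u) ∧
      ts.toList.Pairwise (fun a b => ¬ PEq a b) := by
  simp [IsN, not_isA_or]

theorem isN_and_iff {ts : SandTreeList B} :
    IsN (.and ts) ↔ 2 ≤ ts.toList.length ∧ ∀ u ∈ ts.toList, IsS u := by
  simp [IsN, IsA, not_isS_and, isC_and_iff]

theorem isN_sand_iff {ts : SandTreeList B} :
    IsN (.sand ts) ↔ 2 ≤ ts.toList.length ∧ ∀ u ∈ ts.toList, IsC u := by
  simp [IsN, IsA, not_isC_sand, isS_sand_iff]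

theorem IsC.isN {t : SandTree B} (h : IsC t) : IsN t := .inl (.inl h)
theorem IsS.isN {t : SandTree B} (h : IsS t) : IsN t := .inl (.inr h)
theorem IsA.isN {t : SandTree B} (h : IsA t) : IsN t := .inl h

theorem IsN.isA {t : SandTree B} (h : IsN t) (hor : ∀ ts, t ≠ .or ts) : IsA t := by
  rcases h with h | ⟨ts, rfl, -⟩
  · exact h
  · exact absurd rfl (hor ts)

theorem IsN.isS {t : SandTree B} (h : IsN t) (hor : ∀ ts, t ≠ .or ts)
    (hand : ∀ ts, t ≠ .and ts) : IsS t := by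
  rcases h.isA hor with h | h
  · cases h with
    | atom b => exact .atom b
    | and => exact absurd rfl (hand _)
  · exact h

theorem IsN.isC {t : SandTree B} (h : IsN t) (hor : ∀ ts, t ≠ .or ts)
    (hsand : ∀ ts, t ≠ .sand ts) : IsC t := by
  rcases h.isA hor with h | h
  · exact h
  · cases h with
    | atom b => exact .atom b
    | sand => exact absurd rfl (hsand _)

theorem PEqL.refl (ts : SandTreeList B) : PEqL ts ts := by
  induction ts using list_induction with
  | single t => exact .single (.refl t)
  | cons t ts ih => exact .cons (.refl t) ih

theorem PEqL.ofList {a b : SandTree B} (h : PEq a b) (xs : List (SandTree B)) :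
    PEqL (ofList a xs) (ofList b xs) := by
  cases xs with
  | nil => simpa [SandTreeList.ofList] using PEqL.single h
  | cons x xs => simpa [SandTreeList.ofList] using PEqL.cons h (.refl _)

/-- Two trees belong to the same non-terminals of the normal-form grammar. -/
def SameClass (t u : SandTree B) : Prop :=
  (IsC t ↔ IsC u) ∧ (IsS t ↔ IsS u) ∧ (IsN t ↔ IsN u)

theorem SameClass.isA_iff {t u : SandTree B} (h : SameClass t u) : IsA t ↔ IsA u := by
  rw [IsA, IsA, h.1, h.2.1]

theorem List.Forall₂.forall_mem_iff {α β : Type*} {r : α → β → Prop} {p : α → Prop}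
    {q : β → Prop} (hpq : ∀ a b, r a b → (p a ↔ q b)) {l : List α} {l' : List β}
    (h : List.Forall₂ r l l') : (∀ a ∈ l, p a) ↔ ∀ b ∈ l', q b := by
  induction h with
  | nil => simp
  | cons hab _ ih => simp only [List.forall_mem_cons, hpq _ _ hab, ih]

theorem List.Forall₂.pairwise_iff {α β : Type*} {r : α → β → Prop} {p : α → α → Prop}
    {q : β → β → Prop} (hpq : ∀ a b a' b', r a b → r a' b' → (p a a' ↔ q b b'))
    {l : List α} {l' : List β} (h : List.Forall₂ r l l') : l.Pairwise p ↔ l'.Pairwise q := by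
  induction h with
  | nil => simp
  | cons hab hl ih =>
    rw [List.pairwise_cons, List.pairwise_cons, ih,
      hl.forall_mem_iff fun a' b' h' => hpq _ _ a' b' hab h']

theorem PEq.congr_iff {a b a' b' : SandTree B} (h : PEq a b) (h' : PEq a' b') :
    PEq a a' ↔ PEq b b' :=
  ⟨fun e => h.symm.trans (e.trans h'), fun e => h.trans (e.trans h'.symm)⟩

mutual
theorem PEq.sameClass {t u : SandTree B} : PEq t u → SameClass t u
  | .refl _ => ⟨Iff.rfl, Iff.rfl, Iff.rfl⟩
  | .symm h =>
    have ⟨hC, hS, hN⟩ := h.sameClass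
    ⟨hC.symm, hS.symm, hN.symm⟩
  | .trans h₁ h₂ =>
    have ⟨hC₁, hS₁, hN₁⟩ := h₁.sameClass
    have ⟨hC₂, hS₂, hN₂⟩ := h₂.sameClass
    ⟨hC₁.trans hC₂, hS₁.trans hS₂, hN₁.trans hN₂⟩
  | .orPerm hp => by
    have h := hp.pairwise_iff (R := fun a b => ¬ PEq a b) fun hab hba => hab (PEq.symm hba)
    simp only [SameClass, not_isC_or, not_isS_or, isN_or_iff, hp.length_eq, hp.mem_iff, h,
      and_self]
  | .andPerm hp => by
    simp only [SameClass, isC_and_iff, not_isS_and, isN_and_iff, hp.length_eq, hp.mem_iff,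
      and_self]
  | .orCongr hl => by
    have h := hl.sameClass
    simp only [SameClass, not_isC_or, not_isS_or, isN_or_iff, h.length_eq,
      h.forall_mem_iff fun _ _ hab => hab.2.isA_iff,
      h.pairwise_iff fun _ _ _ _ hab hab' => not_congr (hab.1.congr_iff hab'.1), and_self]
  | .andCongr hl => by
    have h := hl.sameClass
    simp only [SameClass, isC_and_iff, not_isS_and, isN_and_iff, h.length_eq,
      h.forall_mem_iff fun _ _ hab => hab.2.2.1, and_self]
  | .sandCongr hl => by
    have h := hl.sameClass
    simp only [SameClass, isS_sand_iff, not_isC_sand, isN_sand_iff, h.length_eq,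
      h.forall_mem_iff fun _ _ hab => hab.2.1, and_self]
theorem PEqL.sameClass {ts us : SandTreeList B} : PEqL ts us →
    List.Forall₂ (fun t u => PEq t u ∧ SameClass t u) ts.toList us.toList
  | .single h => by
    simpa using ⟨h, h.sameClass⟩
  | .cons h hl => by
    simpa using ⟨⟨h, h.sameClass⟩, hl.sameClass⟩
end

theorem RStep.not_isN {t t' : SandTree B} (h : RStep t t') : ¬ IsN t := by
  cases h with
  | r3 xs ys => exact fun h => not_isA_or ys ((isN_or_iff.1 h).2.1 _ (by simp))
  | r4 xs ys => exact fun h => not_isS_and ys ((isN_and_iff.1 h).2 _ (by simp))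
  | r4' xs ys zs => exact fun h => not_isC_sand ys ((isN_sand_iff.1 h).2 _ (by simp [snoc]))
  | r5 => simp [isN_or_iff]
  | r6 => simp [isN_and_iff]
  | r6' => simp [isN_sand_iff]
  | r10 xs ys => exact fun h => not_isS_or ys ((isN_and_iff.1 h).2 _ (by simp))
  | r10' xs ys zs => exact fun h => not_isC_or ys ((isN_sand_iff.1 h).2 _ (by simp [snoc]))
  | r11 a xs => simp [isN_or_iff, PEq.refl]

mutual
theorem Rw.not_isN {t t' : SandTree B} : Rw t t' → ¬ IsN t
  | .root h => h.not_isN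
  | .or h => fun hN =>
    have ⟨u, hu, hn⟩ := h.exists_not_isN
    hn ((isN_or_iff.1 hN).2.1 u hu).isN
  | .and h => fun hN =>
    have ⟨u, hu, hn⟩ := h.exists_not_isN
    hn ((isN_and_iff.1 hN).2 u hu).isN
  | .sand h => fun hN =>
    have ⟨u, hu, hn⟩ := h.exists_not_isN
    hn ((isN_sand_iff.1 hN).2 u hu).isN
theorem RwL.exists_not_isN {ts ts' : SandTreeList B} :
    RwL ts ts' → ∃ u ∈ ts.toList, ¬ IsN u
  | .single h => ⟨_, by simp, h.not_isN⟩
  | .head h => ⟨_, by simp, h.not_isN⟩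
  | .tail h =>
    have ⟨u, hu, hn⟩ := h.exists_not_isN
    ⟨u, by simp [hu], hn⟩
end

theorem IsN.normalForm {t : SandTree B} (h : IsN t) : NormalForm t :=
  fun _ _ hp hr => hr.not_isN (hp.sameClass.2.2.1 h)

theorem exists_peqL_rwL_of_mem {u v w : SandTree B} {ts : SandTreeList B}
    (hu : u ∈ ts.toList) (hp : PEq u v) (hr : Rw v w) :
    ∃ ts' ts'', PEqL ts ts' ∧ RwL ts' ts'' := by
  induction ts using list_induction with
  | single t =>
    obtain rfl : u = t := by simpa using hu
    exact ⟨_, _, .single hp, .single hr⟩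
  | cons t ts ih =>
    rw [toList_cons, List.mem_cons] at hu
    rcases hu with rfl | hu
    · exact ⟨_, _, .cons hp (.refl ts), .head hr⟩
    · obtain ⟨ts', ts'', hp', hr'⟩ := ih hu
      exact ⟨_, _, .cons (.refl t) hp', .tail hr'⟩

theorem NormalForm.of_mem_or {ts : SandTreeList B} (h : NormalForm (.or ts))
    {u : SandTree B} (hu : u ∈ ts.toList) : NormalForm u := fun _ _ hp hr =>
  have ⟨_, _, hp', hr'⟩ := exists_peqL_rwL_of_mem hu hp hr
  h _ _ (.orCongr hp') (.or hr')

theorem NormalForm.of_mem_and {ts : SandTreeList B} (h : NormalForm (.and ts))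
    {u : SandTree B} (hu : u ∈ ts.toList) : NormalForm u := fun _ _ hp hr =>
  have ⟨_, _, hp', hr'⟩ := exists_peqL_rwL_of_mem hu hp hr
  h _ _ (.andCongr hp') (.and hr')

theorem NormalForm.of_mem_sand {ts : SandTreeList B} (h : NormalForm (.sand ts))
    {u : SandTree B} (hu : u ∈ ts.toList) : NormalForm u := fun _ _ hp hr =>
  have ⟨_, _, hp', hr'⟩ := exists_peqL_rwL_of_mem hu hp hr
  h _ _ (.sandCongr hp') (.sand hr')

theorem NormalForm.isN_or {ts : SandTreeList B} (h : NormalForm (.or ts))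
    (hts : ∀ u ∈ ts.toList, IsN u) : IsN (.or ts) := by
  refine isN_or_iff.2 ⟨two_le_length_toList ?_, fun u hu => (hts u hu).isA ?_, ?_⟩
  · rintro t rfl
    exact h _ _ (.refl _) (.root (.r5 t))
  · rintro ys rfl
    obtain ⟨xs, hp⟩ := exists_perm_glue_of_mem hu
    exact h _ _ (.orPerm hp) (.root (.r3 xs ys))
  · by_contra hd
    obtain ⟨a, b, xs, hab, hp⟩ := List.exists_perm_of_not_pairwise hd
    refine h _ _ (.trans (.orPerm (ts' := .cons a (ofList b xs)) (by simpa using hp))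
      (.orCongr (.cons (.refl a) (.ofList hab.symm xs)))) (.root (.r11 a xs))

theorem NormalForm.isN_and {ts : SandTreeList B} (h : NormalForm (.and ts))
    (hts : ∀ u ∈ ts.toList, IsN u) : IsN (.and ts) := by
  refine isN_and_iff.2 ⟨two_le_length_toList ?_, fun u hu => (hts u hu).isS ?_ ?_⟩
  · rintro t rfl
    exact h _ _ (.refl _) (.root (.r6 t))
  · rintro ys rfl
    obtain ⟨xs, hp⟩ := exists_perm_glue_of_mem hu
    exact h _ _ (.andPerm hp) (.root (.r10 xs ys))
  · rintro ys rfl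
    obtain ⟨xs, hp⟩ := exists_perm_glue_of_mem hu
    exact h _ _ (.andPerm hp) (.root (.r4 xs ys))

theorem NormalForm.isN_sand {ts : SandTreeList B} (h : NormalForm (.sand ts))
    (hts : ∀ u ∈ ts.toList, IsN u) : IsN (.sand ts) := by
  refine isN_sand_iff.2 ⟨two_le_length_toList ?_, fun u hu => (hts u hu).isC ?_ ?_⟩
  · rintro t rfl
    exact h _ _ (.refl _) (.root (.r6' t))
  · rintro ys rfl
    obtain ⟨xs, zs, rfl⟩ := exists_eq_glue_snoc_of_mem hu
    exact h _ _ (.refl _) (.root (.r10' xs ys zs))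
  · rintro ys rfl
    obtain ⟨xs, zs, rfl⟩ := exists_eq_glue_snoc_of_mem hu
    exact h _ _ (.refl _) (.root (.r4' xs ys zs))

mutual
theorem NormalForm.isN : ∀ {t : SandTree B}, NormalForm t → IsN t
  | .atom b, _ => (IsC.atom b).isN
  | .or ts, h => h.isN_or (NormalForm.isN_of_mem ts fun _ => h.of_mem_or)
  | .and ts, h => h.isN_and (NormalForm.isN_of_mem ts fun _ => h.of_mem_and)
  | .sand ts, h => h.isN_sand (NormalForm.isN_of_mem ts fun _ => h.of_mem_sand)
theorem NormalForm.isN_of_mem : ∀ (ts : SandTreeList B),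
    (∀ u ∈ ts.toList, NormalForm u) → ∀ u ∈ ts.toList, IsN u
  | .single t, h => by
    simpa using NormalForm.isN (h t (by simp))
  | .cons t ts, h => by
    rw [toList_cons, List.forall_mem_cons] at h ⊢
    exact ⟨NormalForm.isN h.1, NormalForm.isN_of_mem ts h.2⟩
end

/-- A SAND attack tree is a normal form of the term rewriting
system `⇒` (no rule applicable, modulo commutativity of `OR` and `AND`) iff it
is generated by the non-terminal `N` of the normal-form grammar. -/
theorem normalform_iff_N (B : Type) (t : SandTree B) : NormalForm t ↔ IsN t := by
  exact ⟨NormalForm.isN, IsN.normalForm⟩
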